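/- Let k be a field of characteristic zero and let C = k[x, y, z, z⁻¹] be the localization of the polynomial ring k[x, y, z] at the powers of z. Let σ be the unique k-algebra automorphism of C with σ(x) = y, σ(y) = x, and σ(z) = −z; it is an involution. Then the fixed subalgebra C^σ equals the k-subalgebra of C generated by the five elements X = x + y, U = xy, Z = z², Z⁻¹ = z⁻², and W = (x − y)z. Moreover, the kernel of the k-algebra homomorphism from the Laurent polynomial ring k[X, U, Z, Z⁻¹, W] (polynomial in X, U, W and Laurent in Z) onto C^σ sending the variables to these elements is generated by the single relation W² − Z(X² − 4U); that is, C^σ is the hypersurface W² = Z(X² − 4U) with Z inverted. -/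

import Mathlib

namespace LaurentPolynomial

section

variable {R ι : Type*} [CommRing R]

theorem T_one_mul_T_neg_one : (T 1 * T (-1) : R[T;T⁻¹]) = 1 := by
  rw [← T_add, add_neg_cancel, T_zero]

theorem T_two : (T 2 : R[T;T⁻¹]) = T 1 ^ 2 := by
  simp

/-- A property of Laurent polynomials over `R[X_i : i ∈ ι]` which holds for constants and is stable
under sums and under multiplication by the variables and by `T⁻¹` holds everywhere. -/
theorem induction_on_generators {P : (MvPolynomial ι R)[T;T⁻¹] → Prop}
    (p : (MvPolynomial ι R)[T;T⁻¹]) (h_C : ∀ r, P (algebraMap R _ r))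
    (h_add : ∀ p q, P p → P q → P (p + q)) (h_X : ∀ i p, P p → P (p * C (MvPolynomial.X i)))
    (h_T : ∀ p, P p → P (p * T 1)) (h_T_neg : ∀ p, P p → P (p * T (-1))) : P p := by
  induction p using LaurentPolynomial.induction_on with
  | h_C a =>
    induction a using MvPolynomial.induction_on with
    | C r => exact h_C r
    | add p q hp hq => rw [map_add]; exact h_add _ _ hp hq
    | mul_X p i hp => rw [map_mul]; exact h_X _ _ hp
  | h_add hp hq => exact h_add _ _ hp hq
  | h_C_mul_T n a h => rw [T_add, ← mul_assoc]; exact h_T _ h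
  | h_C_mul_T_Z n a h => rw [sub_eq_add_neg, T_add, ← mul_assoc]; exact h_T_neg _ h

theorem map_T_neg_one {A : Type*} [CommRing A] [Algebra R A] (f : (MvPolynomial ι R)[T;T⁻¹] →ₐ[R] A)
    {u v : A} (hu : f (T 1) = u) (huv : u * v = 1) : f (T (-1)) = v := by
  have h : u * f (T (-1)) = 1 := by rw [← hu, ← map_mul, T_one_mul_T_neg_one, map_one]
  linear_combination v * h - f (T (-1)) * huv

theorem algHom_ext_generators {A : Type*} [CommRing A] [Algebra R A]
    {f g : (MvPolynomial ι R)[T;T⁻¹] →ₐ[R] A}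
    (hX : ∀ i, f (C (MvPolynomial.X i)) = g (C (MvPolynomial.X i))) (hT : f (T 1) = g (T 1)) :
    f = g := by
  refine AlgHom.ext fun p => ?_
  induction p using induction_on_generators with
  | h_C r => simp only [AlgHom.commutes]
  | h_add p q hp hq => rw [map_add, map_add, hp, hq]
  | h_X i p hp => rw [map_mul, map_mul, hp, hX]
  | h_T p hp => rw [map_mul, map_mul, hp, hT]
  | h_T_neg p hp =>
    rw [map_mul, map_mul, hp, map_T_neg_one f hT (v := g (T (-1)))]
    rw [← map_mul, T_one_mul_T_neg_one, map_one]

end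

section

variable {k : Type*} [Field k]

theorem mapAlgHom_C {R S : Type*} [CommRing R] [CommRing S] [Algebra k R] [Algebra k S]
    (f : R →ₐ[k] S) (r : R) : AddMonoidAlgebra.mapAlgHom ℤ f (C r) = C (f r) :=
  AddMonoidAlgebra.mapAlgHom_single f 0 r

theorem mapAlgHom_T {R S : Type*} [CommRing R] [CommRing S] [Algebra k R] [Algebra k S]
    (f : R →ₐ[k] S) (n : ℤ) : AddMonoidAlgebra.mapAlgHom ℤ f (T n) = T n := by
  rw [T, AddMonoidAlgebra.mapAlgHom_single, map_one, T]

theorem _root_.MvPolynomial.aeval_add_mul_injective :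
    Function.Injective (MvPolynomial.aeval (R := k)
      ![(MvPolynomial.X 0 + MvPolynomial.X 1 : MvPolynomial (Fin 2) k),
        MvPolynomial.X 0 * MvPolynomial.X 1]) := by
  have h := Subtype.val_injective.comp (MvPolynomial.esymmAlgHom_fin_injective k (le_refl 2))
  convert h using 1
  ext1 p
  rw [Function.comp_apply, MvPolynomial.esymmAlgHom_apply]
  congr 2
  ext1 i
  fin_cases i
  · simp [MvPolynomial.esymm_one]
  · have : (Finset.powersetCard 2 (Finset.univ : Finset (Fin 2))) = {{0, 1}} := by decide
    simp [MvPolynomial.esymm, this]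

/-- The homomorphism `x ↦ x + y`, `y ↦ x y`, `z ↦ z²` of `k[x, y, z, z⁻¹]` is injective. -/
theorem injective_of_map_symmetric
    {ψ : (MvPolynomial (Fin 2) k)[T;T⁻¹] →ₐ[k] (MvPolynomial (Fin 2) k)[T;T⁻¹]}
    (hX : ψ (C (MvPolynomial.X 0)) = C (MvPolynomial.X 0) + C (MvPolynomial.X 1))
    (hU : ψ (C (MvPolynomial.X 1)) = C (MvPolynomial.X 0) * C (MvPolynomial.X 1))
    (hT : ψ (T 1) = T 2) : Function.Injective ψ := by
  set e := MvPolynomial.aeval (R := k)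
      ![(MvPolynomial.X 0 + MvPolynomial.X 1 : MvPolynomial (Fin 2) k),
        MvPolynomial.X 0 * MvPolynomial.X 1] with he
  have hψ : ψ = (AddMonoidAlgebra.mapDomainAlgHom k _ (AddMonoidHom.mulLeft (2 : ℤ))).comp
      (AddMonoidAlgebra.mapAlgHom ℤ e) := by
    have hC (a : MvPolynomial (Fin 2) k) :
        AddMonoidAlgebra.mapDomainAlgHom k _ (AddMonoidHom.mulLeft (2 : ℤ)) (C a) = C a := by
      rw [← single_eq_C, AddMonoidAlgebra.mapDomainAlgHom_apply, AddMonoidAlgebra.mapDomain_single,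
        map_zero]
    refine algHom_ext_generators (fun i => ?_) ?_
    · rw [AlgHom.comp_apply, mapAlgHom_C, hC, he, MvPolynomial.aeval_X]
      fin_cases i
      · simpa using hX
      · simpa using hU
    · rw [AlgHom.comp_apply, mapAlgHom_T, hT, AddMonoidAlgebra.mapDomainAlgHom_apply, T, T,
        AddMonoidAlgebra.mapDomain_single]
      rfl
  rw [hψ, AlgHom.coe_comp]
  refine Function.Injective.comp ?_ ?_
  · exact AddMonoidAlgebra.mapDomain_injective (mul_right_injective₀ two_ne_zero)
  · exact AddMonoidAlgebra.map_injective (e : MvPolynomial (Fin 2) k →+ MvPolynomial (Fin 2) k)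
      MvPolynomial.aeval_add_mul_injective

/-- An endomorphism of `k[x, y, z, z⁻¹]` which exchanges `x` and `y` and fixes `z²` fixes
`k[x + y, x y, z², z⁻²]`. -/
theorem map_eq_of_map_symmetric
    {ψ : (MvPolynomial (Fin 2) k)[T;T⁻¹] →ₐ[k] (MvPolynomial (Fin 2) k)[T;T⁻¹]}
    (hX : ψ (C (MvPolynomial.X 0)) = C (MvPolynomial.X 0) + C (MvPolynomial.X 1))
    (hU : ψ (C (MvPolynomial.X 1)) = C (MvPolynomial.X 0) * C (MvPolynomial.X 1))
    (hT : ψ (T 1) = T 2)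
    {θ : (MvPolynomial (Fin 2) k)[T;T⁻¹] →ₐ[k] (MvPolynomial (Fin 2) k)[T;T⁻¹]}
    (hx : θ (C (MvPolynomial.X 0)) = C (MvPolynomial.X 1))
    (hy : θ (C (MvPolynomial.X 1)) = C (MvPolynomial.X 0))
    (hz : θ (T 2) = T 2) (a : (MvPolynomial (Fin 2) k)[T;T⁻¹]) : θ (ψ a) = ψ a := by
  suffices h : θ.comp ψ = ψ from DFunLike.congr_fun h a
  refine algHom_ext_generators (fun i => ?_) ?_
  · rw [AlgHom.comp_apply]
    fin_cases i
    · simp only [Fin.zero_eta, hX, map_add, hx, hy, add_comm]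
    · simp only [Fin.mk_one, hU, map_mul, hx, hy, mul_comm]
  · rw [AlgHom.comp_apply, hT, hz]

theorem two_mul_algebraMap_inv_two [CharZero k] {A : Type*} [CommRing A] [Algebra k A] :
    2 * algebraMap k A 2⁻¹ = 1 := by
  rw [← map_ofNat (algebraMap k A) 2, ← map_mul, mul_inv_cancel₀ two_ne_zero, map_one]

theorem two_ne_zero_of_algebra (k : Type*) [Field k] [CharZero k] {A : Type*} [CommRing A]
    [Nontrivial A] [Algebra k A] : (2 : A) ≠ 0 :=
  left_ne_zero_of_mul_eq_one (two_mul_algebraMap_inv_two (k := k))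

/-- `k[x, y, z, z⁻¹]` is spanned by `1`, `x - y`, `z` and `(x - y) z` over
`k[x + y, x y, z², z⁻²]`. -/
theorem exists_eq_of_map_symmetric [CharZero k]
    {ψ : (MvPolynomial (Fin 2) k)[T;T⁻¹] →ₐ[k] (MvPolynomial (Fin 2) k)[T;T⁻¹]}
    (hX : ψ (C (MvPolynomial.X 0)) = C (MvPolynomial.X 0) + C (MvPolynomial.X 1))
    (hU : ψ (C (MvPolynomial.X 1)) = C (MvPolynomial.X 0) * C (MvPolynomial.X 1))
    (hT : ψ (T 1) = T 2) (c : (MvPolynomial (Fin 2) k)[T;T⁻¹]) :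
    ∃ a b e f, c = ψ a + ψ b * (C (MvPolynomial.X 0) - C (MvPolynomial.X 1)) + ψ e * T 1 +
      ψ f * ((C (MvPolynomial.X 0) - C (MvPolynomial.X 1)) * T 1) := by
  have hi := two_mul_algebraMap_inv_two (k := k) (A := (MvPolynomial (Fin 2) k)[T;T⁻¹])
  have hψi := ψ.commutes 2⁻¹
  have hz := T_one_mul_T_neg_one (R := MvPolynomial (Fin 2) k)
  have hT' : ψ (T (-1)) = T (-1) ^ 2 :=
    map_T_neg_one ψ hT (by rw [T_two, ← mul_pow, hz, one_pow])
  rw [T_two] at hT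
  set i := algebraMap k (MvPolynomial (Fin 2) k)[T;T⁻¹] 2⁻¹
  set x : (MvPolynomial (Fin 2) k)[T;T⁻¹] := C (MvPolynomial.X 0)
  set y : (MvPolynomial (Fin 2) k)[T;T⁻¹] := C (MvPolynomial.X 1)
  induction c using induction_on_generators with
  | h_C r => exact ⟨algebraMap k _ r, 0, 0, 0, by
    simp only [AlgHom.commutes, map_zero, zero_mul, add_zero]⟩
  | h_add p q hp hq =>
    obtain ⟨a, b, e, f, rfl⟩ := hp
    obtain ⟨a', b', e', f', rfl⟩ := hq
    exact ⟨a + a', b + b', e + e', f + f', by simp only [map_add]; ring⟩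
  | h_X j p hp =>
    obtain ⟨a, b, e, f, hp⟩ := hp
    fin_cases j
    · refine ⟨i * (x * a + (x ^ 2 - 4 * y) * b), i * (x * b + a),
        i * (x * e + (x ^ 2 - 4 * y) * f), i * (x * f + e), ?_⟩
      simp only [map_add, map_mul, map_sub, map_pow, map_ofNat, hψi, hX, hU]
      change p * x = _
      rw [hp]
      linear_combination -(x * (ψ a + ψ b * (x - y) + ψ e * T 1 + ψ f * ((x - y) * T 1))) * hi
    · refine ⟨i * (x * a - (x ^ 2 - 4 * y) * b), i * (x * b - a),
        i * (x * e - (x ^ 2 - 4 * y) * f), i * (x * f - e), ?_⟩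
      simp only [map_mul, map_sub, map_pow, map_ofNat, hψi, hX, hU]
      change p * y = _
      rw [hp]
      linear_combination -(y * (ψ a + ψ b * (x - y) + ψ e * T 1 + ψ f * ((x - y) * T 1))) * hi
  | h_T p hp =>
    obtain ⟨a, b, e, f, rfl⟩ := hp
    refine ⟨e * T 1, f * T 1, a, b, ?_⟩
    simp only [map_mul, hT]
    ring
  | h_T_neg p hp =>
    obtain ⟨a, b, e, f, rfl⟩ := hp
    refine ⟨e, f, a * T (-1), b * T (-1), ?_⟩
    simp only [map_mul, hT']
    linear_combination (ψ e + ψ f * (x - y) - ψ a * T (-1) - ψ b * (x - y) * T (-1)) * hz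

/-- Modulo `W² - Z (X² - 4 U)`, every element of `k[X, U, W, Z, Z⁻¹]` has degree at most one
in `W`. -/
theorem exists_eq_add_mul_relation
    {j : (MvPolynomial (Fin 2) k)[T;T⁻¹] →ₐ[k] (MvPolynomial (Fin 3) k)[T;T⁻¹]}
    (hX : j (C (MvPolynomial.X 0)) = C (MvPolynomial.X 0))
    (hU : j (C (MvPolynomial.X 1)) = C (MvPolynomial.X 1))
    (hT : j (T 1) = T 1) (p : (MvPolynomial (Fin 3) k)[T;T⁻¹]) :
    ∃ a b q, p = j a + j b * C (MvPolynomial.X 2) +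
      q * (C (MvPolynomial.X 2) ^ 2 -
        T 1 * (C (MvPolynomial.X 0) ^ 2 - 4 * C (MvPolynomial.X 1))) := by
  have hT' : j (T (-1)) = T (-1) := map_T_neg_one j hT T_one_mul_T_neg_one
  induction p using induction_on_generators with
  | h_C r => exact ⟨algebraMap k _ r, 0, 0, by
    simp only [AlgHom.commutes, map_zero, zero_mul, add_zero]⟩
  | h_add p q hp hq =>
    obtain ⟨a, b, e, rfl⟩ := hp
    obtain ⟨a', b', e', rfl⟩ := hq
    exact ⟨a + a', b + b', e + e', by simp only [map_add]; ring⟩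
  | h_X i p hp =>
    obtain ⟨a, b, q, rfl⟩ := hp
    fin_cases i
    · refine ⟨a * C (MvPolynomial.X 0), b * C (MvPolynomial.X 0), q * C (MvPolynomial.X 0), ?_⟩
      simp only [map_mul, hX, Fin.zero_eta]
      ring
    · refine ⟨a * C (MvPolynomial.X 1), b * C (MvPolynomial.X 1), q * C (MvPolynomial.X 1), ?_⟩
      simp only [map_mul, hU, Fin.mk_one]
      ring
    · refine ⟨b * (T 1 * (C (MvPolynomial.X 0) ^ 2 - 4 * C (MvPolynomial.X 1))), a,
        j b + q * C (MvPolynomial.X 2), ?_⟩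
      simp only [map_mul, map_sub, map_pow, map_ofNat, hX, hU, hT, Fin.reduceFinMk]
      ring
  | h_T p hp =>
    obtain ⟨a, b, q, rfl⟩ := hp
    refine ⟨a * T 1, b * T 1, q * T 1, ?_⟩
    simp only [map_mul, hT]
    ring
  | h_T_neg p hp =>
    obtain ⟨a, b, q, rfl⟩ := hp
    refine ⟨a * T (-1), b * T (-1), q * T (-1), ?_⟩
    simp only [map_mul, hT']
    ring

/-- The polynomialInclusion of `k[X, U, Z, Z⁻¹]` into `k[X, U, W, Z, Z⁻¹]`. -/
noncomputable def polynomialInclusion :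
    (MvPolynomial (Fin 2) k)[T;T⁻¹] →ₐ[k] (MvPolynomial (Fin 3) k)[T;T⁻¹] :=
  AddMonoidAlgebra.mapAlgHom ℤ (MvPolynomial.rename Fin.castSucc)

theorem polynomialInclusion_X_zero :
    polynomialInclusion (k := k) (C (MvPolynomial.X 0)) = C (MvPolynomial.X 0) := by
  rw [polynomialInclusion, mapAlgHom_C, MvPolynomial.rename_X, Fin.castSucc_zero]

theorem polynomialInclusion_X_one :
    polynomialInclusion (k := k) (C (MvPolynomial.X 1)) = C (MvPolynomial.X 1) := by
  rw [polynomialInclusion, mapAlgHom_C, MvPolynomial.rename_X, Fin.castSucc_one]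

theorem polynomialInclusion_T (n : ℤ) : polynomialInclusion (k := k) (T n) = T n :=
  mapAlgHom_T _ _

theorem involutive_of_swap
    {σ : (MvPolynomial (Fin 2) k)[T;T⁻¹] ≃ₐ[k] (MvPolynomial (Fin 2) k)[T;T⁻¹]}
    (hσx : σ (C (MvPolynomial.X 0)) = C (MvPolynomial.X 1))
    (hσy : σ (C (MvPolynomial.X 1)) = C (MvPolynomial.X 0))
    (hσz : σ (T 1) = -T 1) (c : (MvPolynomial (Fin 2) k)[T;T⁻¹]) : σ (σ c) = c := by
  suffices h : σ.toAlgHom.comp σ.toAlgHom = AlgHom.id k _ from DFunLike.congr_fun h c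
  refine algHom_ext_generators (fun i => ?_) ?_
  · fin_cases i
    · simp [hσx, hσy]
    · simp [hσx, hσy]
  · simp [hσz]

theorem equalizer_le_range [CharZero k]
    {σ : (MvPolynomial (Fin 2) k)[T;T⁻¹] ≃ₐ[k] (MvPolynomial (Fin 2) k)[T;T⁻¹]}
    (hσx : σ (C (MvPolynomial.X 0)) = C (MvPolynomial.X 1))
    (hσy : σ (C (MvPolynomial.X 1)) = C (MvPolynomial.X 0))
    (hσz : σ (T 1) = -T 1)
    {φ : (MvPolynomial (Fin 3) k)[T;T⁻¹] →ₐ[k] (MvPolynomial (Fin 2) k)[T;T⁻¹]}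
    (hφX : φ (C (MvPolynomial.X 0)) = C (MvPolynomial.X 0) + C (MvPolynomial.X 1))
    (hφU : φ (C (MvPolynomial.X 1)) = C (MvPolynomial.X 0) * C (MvPolynomial.X 1))
    (hφW : φ (C (MvPolynomial.X 2)) = (C (MvPolynomial.X 0) - C (MvPolynomial.X 1)) * T 1)
    (hφZ : φ (T 1) = T 2) :
    AlgHom.equalizer σ.toAlgHom (AlgHom.id k (MvPolynomial (Fin 2) k)[T;T⁻¹]) ≤ φ.range := by
  have hσT : σ (T 2) = T 2 := by
    rw [T_two, map_pow, hσz]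
    ring
  have hψX : (φ.comp polynomialInclusion) (C (MvPolynomial.X 0)) =
      C (MvPolynomial.X 0) + C (MvPolynomial.X 1) := by
    rw [AlgHom.comp_apply, polynomialInclusion_X_zero, hφX]
  have hψU : (φ.comp polynomialInclusion) (C (MvPolynomial.X 1)) =
      C (MvPolynomial.X 0) * C (MvPolynomial.X 1) := by
    rw [AlgHom.comp_apply, polynomialInclusion_X_one, hφU]
  have hψT : (φ.comp polynomialInclusion) (T 1) = T 2 := by
    rw [AlgHom.comp_apply, polynomialInclusion_T, hφZ]
  have hσψ (a) : σ (φ (polynomialInclusion a)) = φ (polynomialInclusion a) :=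
    map_eq_of_map_symmetric hψX hψU hψT (θ := σ.toAlgHom) hσx hσy hσT a
  have h_two : (2 : (MvPolynomial (Fin 2) k)[T;T⁻¹]) ≠ 0 :=
    two_ne_zero_of_algebra k
  intro c hc
  have hc : σ c = c := hc
  obtain ⟨a, b, e, f, h⟩ := exists_eq_of_map_symmetric hψX hψU hψT c
  simp only [AlgHom.comp_apply] at h
  have h' := hc
  rw [h] at h'
  simp only [map_add, map_mul, map_sub, hσψ, hσx, hσy, hσz] at h'
  refine ⟨polynomialInclusion a + polynomialInclusion f * C (MvPolynomial.X 2), ?_⟩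
  refine mul_left_cancel₀ h_two ?_
  change 2 * φ _ = _
  rw [map_add, map_mul, hφW, h]
  linear_combination h'

theorem range_le_adjoin
    {φ : (MvPolynomial (Fin 3) k)[T;T⁻¹] →ₐ[k] (MvPolynomial (Fin 2) k)[T;T⁻¹]}
    (hφX : φ (C (MvPolynomial.X 0)) = C (MvPolynomial.X 0) + C (MvPolynomial.X 1))
    (hφU : φ (C (MvPolynomial.X 1)) = C (MvPolynomial.X 0) * C (MvPolynomial.X 1))
    (hφW : φ (C (MvPolynomial.X 2)) = (C (MvPolynomial.X 0) - C (MvPolynomial.X 1)) * T 1)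
    (hφZ : φ (T 1) = T 2) :
    φ.range ≤ Algebra.adjoin k {C (MvPolynomial.X 0) + C (MvPolynomial.X 1),
      C (MvPolynomial.X 0) * C (MvPolynomial.X 1), T 2, T (-2),
      (C (MvPolynomial.X 0) - C (MvPolynomial.X 1)) * T 1} := by
  have hφZ' : φ (T (-1)) = T (-2) :=
    map_T_neg_one φ hφZ (by rw [← T_add, add_neg_cancel, T_zero])
  rintro _ ⟨p, rfl⟩
  change φ p ∈ _
  induction p using induction_on_generators with
  | h_C r => rw [AlgHom.commutes]; exact Subalgebra.algebraMap_mem _ r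
  | h_add p q hp hq => rw [map_add]; exact add_mem hp hq
  | h_X i p hp =>
    rw [map_mul]
    refine mul_mem hp (Algebra.subset_adjoin ?_)
    fin_cases i
    · exact hφX ▸ by simp
    · exact hφU ▸ by simp
    · exact hφW ▸ by simp
  | h_T p hp =>
    rw [map_mul, hφZ]
    exact mul_mem hp (Algebra.subset_adjoin (by simp))
  | h_T_neg p hp =>
    rw [map_mul, hφZ']
    exact mul_mem hp (Algebra.subset_adjoin (by simp))

theorem adjoin_le_equalizer
    {σ : (MvPolynomial (Fin 2) k)[T;T⁻¹] ≃ₐ[k] (MvPolynomial (Fin 2) k)[T;T⁻¹]}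
    (hσx : σ (C (MvPolynomial.X 0)) = C (MvPolynomial.X 1))
    (hσy : σ (C (MvPolynomial.X 1)) = C (MvPolynomial.X 0))
    (hσz : σ (T 1) = -T 1) :
    Algebra.adjoin k {C (MvPolynomial.X 0) + C (MvPolynomial.X 1),
      C (MvPolynomial.X 0) * C (MvPolynomial.X 1), T 2, T (-2),
      (C (MvPolynomial.X 0) - C (MvPolynomial.X 1)) * T 1} ≤
      AlgHom.equalizer σ.toAlgHom (AlgHom.id k (MvPolynomial (Fin 2) k)[T;T⁻¹]) := by
  have hz := T_one_mul_T_neg_one (R := MvPolynomial (Fin 2) k)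
  have hσz' : σ (T (-1)) = -T (-1) :=
    map_T_neg_one σ.toAlgHom hσz (by linear_combination hz)
  have hσT : σ (T 2) = T 2 := by
    rw [T_two, map_pow, hσz]
    ring
  have hσT' : σ (T (-2)) = T (-2) := by
    have h : (T (-2) : (MvPolynomial (Fin 2) k)[T;T⁻¹]) = T (-1) ^ 2 := by simp
    rw [h, map_pow, hσz']
    ring
  refine Algebra.adjoin_le ?_
  rintro c (rfl | rfl | rfl | rfl | rfl)
  · change σ _ = _
    rw [map_add, hσx, hσy, add_comm]
    rfl
  · change σ _ = _
    rw [map_mul, hσx, hσy, mul_comm]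
    rfl
  · exact hσT
  · exact hσT'
  · change σ _ = (_ - _) * _
    rw [map_mul, map_sub, hσx, hσy, hσz]
    ring

theorem ker_eq_span_relation [CharZero k]
    {φ : (MvPolynomial (Fin 3) k)[T;T⁻¹] →ₐ[k] (MvPolynomial (Fin 2) k)[T;T⁻¹]}
    (hφX : φ (C (MvPolynomial.X 0)) = C (MvPolynomial.X 0) + C (MvPolynomial.X 1))
    (hφU : φ (C (MvPolynomial.X 1)) = C (MvPolynomial.X 0) * C (MvPolynomial.X 1))
    (hφW : φ (C (MvPolynomial.X 2)) = (C (MvPolynomial.X 0) - C (MvPolynomial.X 1)) * T 1)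
    (hφZ : φ (T 1) = T 2) :
    RingHom.ker φ.toRingHom = Ideal.span {C (MvPolynomial.X 2) ^ 2 -
      T 1 * (C (MvPolynomial.X 0) ^ 2 - 4 * C (MvPolynomial.X 1))} := by
  have hψX : (φ.comp polynomialInclusion) (C (MvPolynomial.X 0)) =
      C (MvPolynomial.X 0) + C (MvPolynomial.X 1) := by
    rw [AlgHom.comp_apply, polynomialInclusion_X_zero, hφX]
  have hψU : (φ.comp polynomialInclusion) (C (MvPolynomial.X 1)) =
      C (MvPolynomial.X 0) * C (MvPolynomial.X 1) := by
    rw [AlgHom.comp_apply, polynomialInclusion_X_one, hφU]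
  have hψT : (φ.comp polynomialInclusion) (T 1) = T 2 := by
    rw [AlgHom.comp_apply, polynomialInclusion_T, hφZ]
  have h_two : (2 : (MvPolynomial (Fin 2) k)[T;T⁻¹]) ≠ 0 :=
    two_ne_zero_of_algebra k
  have h_rel : φ (C (MvPolynomial.X 2) ^ 2 - T 1 *
      ((C (MvPolynomial.X 0)) ^ 2 -
        4 * C (MvPolynomial.X 1))) = 0 := by
    simp only [map_sub, map_mul, map_pow, map_ofNat, hφX, hφU, hφW, hφZ, T_two]
    ring
  refine le_antisymm (fun p hp => ?_) ((Ideal.span_singleton_le_iff_mem _).2 h_rel)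
  have hp : φ p = 0 := hp
  obtain ⟨a, b, q, rfl⟩ := exists_eq_add_mul_relation polynomialInclusion_X_zero
    polynomialInclusion_X_one (polynomialInclusion_T 1) p
  let τ : (MvPolynomial (Fin 2) k)[T;T⁻¹] →ₐ[k] (MvPolynomial (Fin 2) k)[T;T⁻¹] :=
    AddMonoidAlgebra.mapAlgHom ℤ (MvPolynomial.rename (Equiv.swap 0 1))
  have hτx : τ (C (MvPolynomial.X 0)) = C (MvPolynomial.X 1) := by
    rw [mapAlgHom_C, MvPolynomial.rename_X, Equiv.swap_apply_left]
  have hτy : τ (C (MvPolynomial.X 1)) = C (MvPolynomial.X 0) := by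
    rw [mapAlgHom_C, MvPolynomial.rename_X, Equiv.swap_apply_right]
  have hτz (n : ℤ) : τ (T n) = T n := mapAlgHom_T _ _
  have hτψ (a) : τ (φ (polynomialInclusion a)) = φ (polynomialInclusion a) :=
    map_eq_of_map_symmetric hψX hψU hψT hτx hτy (hτz 2) a
  have h_inj : ∀ c, φ (polynomialInclusion c) = 0 → c = 0 := fun c =>
    (injective_iff_map_eq_zero (φ.comp polynomialInclusion)).1
      (injective_of_map_symmetric hψX hψU hψT) c
  rw [map_add, map_mul, h_rel, mul_zero, add_zero, map_add, map_mul, hφW] at hp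
  have hp' := congrArg τ hp
  simp only [map_add, map_mul, map_sub, map_zero, hτψ, hτx, hτy, hτz] at hp'
  have ha : a = 0 := by
    refine h_inj a ((mul_eq_zero_iff_left h_two).1 ?_)
    linear_combination hp + hp'
  have hb : b = 0 := by
    have h_sub : (C (MvPolynomial.X 0) - C (MvPolynomial.X 1) :
        (MvPolynomial (Fin 2) k)[T;T⁻¹]) ≠ 0 := by
      rw [← map_sub, ← single_eq_C, Ne, AddMonoidAlgebra.single_eq_zero, sub_eq_zero]
      exact fun h => zero_ne_one (MvPolynomial.X_injective h)
    refine h_inj b (mul_right_cancel₀ (mul_ne_zero h_sub (isUnit_T 1).ne_zero) ?_)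
    rw [ha, map_zero, map_zero, zero_add] at hp
    rw [hp, zero_mul]
  rw [ha, hb, map_zero, zero_mul, add_zero, zero_add]
  exact Ideal.mul_mem_left _ q (Ideal.mem_span_singleton_self _)

end

end LaurentPolynomial

/-- **The quotient computation in Example 2.6**: let `C = k[x,y,z,z⁻¹]` (realized as
Laurent polynomials in `z` over `k[x,y] = MvPolynomial (Fin 2) k`, with
`x = C (X 0)`, `y = C (X 1)`, `z = T 1`) and let `σ` be the `k`-algebra involution with
`σ(x) = y`, `σ(y) = x`, `σ(z) = -z`. Then `σ` is an involution, the fixed subalgebra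
`C^σ` is generated over `k` by `X = x + y`, `U = xy`, `Z = z²`, `Z⁻¹ = z⁻²` and
`W = (x - y)z`, and the kernel of the `k`-algebra homomorphism `φ` from the ring
`k[X,U,W][Z,Z⁻¹]` (Laurent polynomials in `Z` over `k[X,U,W] = MvPolynomial (Fin 3) k`)
sending `X ↦ x + y`, `U ↦ xy`, `W ↦ (x - y)z`, `Z ↦ z²` is generated by the single
relation `W² - Z(X² - 4U)`; moreover the image of `φ` is exactly `C^σ`. -/
theorem fixedSubalgebra_of_involution_is_hypersurface
    (k : Type*) [Field k] [CharZero k]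
    (σ : LaurentPolynomial (MvPolynomial (Fin 2) k) ≃ₐ[k]
      LaurentPolynomial (MvPolynomial (Fin 2) k))
    (hσx : σ (LaurentPolynomial.C (MvPolynomial.X 0)) =
      LaurentPolynomial.C (MvPolynomial.X 1))
    (hσy : σ (LaurentPolynomial.C (MvPolynomial.X 1)) =
      LaurentPolynomial.C (MvPolynomial.X 0))
    (hσz : σ (LaurentPolynomial.T 1) = - LaurentPolynomial.T 1)
    (φ : LaurentPolynomial (MvPolynomial (Fin 3) k) →ₐ[k]
      LaurentPolynomial (MvPolynomial (Fin 2) k))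
    (hφX : φ (LaurentPolynomial.C (MvPolynomial.X 0)) =
      LaurentPolynomial.C (MvPolynomial.X 0) + LaurentPolynomial.C (MvPolynomial.X 1))
    (hφU : φ (LaurentPolynomial.C (MvPolynomial.X 1)) =
      LaurentPolynomial.C (MvPolynomial.X 0) * LaurentPolynomial.C (MvPolynomial.X 1))
    (hφW : φ (LaurentPolynomial.C (MvPolynomial.X 2)) =
      (LaurentPolynomial.C (MvPolynomial.X 0) - LaurentPolynomial.C (MvPolynomial.X 1)) *
        LaurentPolynomial.T 1)
    (hφZ : φ (LaurentPolynomial.T 1) = LaurentPolynomial.T 2) :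
    -- `σ` is an involution
    (∀ c, σ (σ c) = c) ∧
    -- the fixed subalgebra `C^σ` is generated by the five elements
    AlgHom.equalizer σ.toAlgHom (AlgHom.id k (LaurentPolynomial (MvPolynomial (Fin 2) k))) =
      Algebra.adjoin k
        {LaurentPolynomial.C (MvPolynomial.X 0) + LaurentPolynomial.C (MvPolynomial.X 1),
         LaurentPolynomial.C (MvPolynomial.X 0) * LaurentPolynomial.C (MvPolynomial.X 1),
         LaurentPolynomial.T 2, LaurentPolynomial.T (-2),
         (LaurentPolynomial.C (MvPolynomial.X 0) - LaurentPolynomial.C (MvPolynomial.X 1)) *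
           LaurentPolynomial.T 1} ∧
    -- `φ` maps onto `C^σ` ...
    φ.range =
      AlgHom.equalizer σ.toAlgHom
        (AlgHom.id k (LaurentPolynomial (MvPolynomial (Fin 2) k))) ∧
    -- ... and its kernel is generated by the single relation `W² - Z(X² - 4U)`
    RingHom.ker φ.toRingHom = Ideal.span
      {LaurentPolynomial.C (MvPolynomial.X 2) ^ 2 -
        LaurentPolynomial.T 1 *
          ((LaurentPolynomial.C (MvPolynomial.X 0)) ^ 2 -
            4 * LaurentPolynomial.C (MvPolynomial.X 1))} := by
  have h_fixed := LaurentPolynomial.equalizer_le_range hσx hσy hσz hφX hφU hφW hφZ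
  have h_range := LaurentPolynomial.range_le_adjoin hφX hφU hφW hφZ
  have h_adjoin := LaurentPolynomial.adjoin_le_equalizer hσx hσy hσz
  exact ⟨LaurentPolynomial.involutive_of_swap hσx hσy hσz,
    le_antisymm (h_fixed.trans h_range) h_adjoin, le_antisymm (h_range.trans h_adjoin) h_fixed,
    LaurentPolynomial.ker_eq_span_relation hφX hφU hφW hφZ⟩
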